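/- arXiv:2510.08602 — 3 statements merged into one kernel-verified Lean document; each statement's English description precedes it below -/
import Mathlib

section
/- Let D = (q_M, q_H, P_M, P_H) and D̂ = (q_M, q_H, P̂_M, P̂_H) be two data distributions with the same class weights, both consistent with the same ground-truth function p̂. Then ∫ P_D̂(x)²/P_D(x) dμ(x) ≥ q_H·(D_χ²(P̂_H‖P_H) + 1), where P_D and P_D̂ are the joint text densities of D and D̂. -/
open MeasureTheory Real

/-- The integral `∫ f² / g` of two positive probability densities is at least `1`. -/
lemma one_le_lintegral_sq_div {X : Type*} [MeasurableSpace X] {μ : Measure X} {f g : X → ℝ}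
    (hf : Measurable f) (hg : Measurable g) (hfpos : ∀ x, 0 < f x) (hgpos : ∀ x, 0 < g x)
    (hfone : ∫ x, f x ∂μ = 1) (hgone : ∫ x, g x ∂μ = 1) :
    1 ≤ ∫⁻ x, ENNReal.ofReal (f x ^ 2 / g x) ∂μ := by
  have lintegral_eq_one {h : X → ℝ} (hpos : ∀ x, 0 < h x) (hone : ∫ x, h x ∂μ = 1) :
      ∫⁻ x, ENNReal.ofReal (h x) ∂μ = 1 := by
    rw [← ofReal_integral_eq_lintegral_ofReal
      (.of_integral_ne_zero (by simp [hone])) (.of_forall fun x => (hpos x).le), hone,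
      ENNReal.ofReal_one]
  have hle : ∫⁻ x, ENNReal.ofReal (f x) + ENNReal.ofReal (f x) ∂μ ≤
      ∫⁻ x, ENNReal.ofReal (f x ^ 2 / g x) + ENNReal.ofReal (g x) ∂μ := by
    refine lintegral_mono fun x => ?_
    have hfx := hfpos x
    have hgx := hgpos x
    rw [← ENNReal.ofReal_add hfx.le hfx.le, ← ENNReal.ofReal_add (by positivity) hgx.le]
    refine ENNReal.ofReal_le_ofReal ?_
    rw [div_add' _ _ _ hgx.ne', le_div_iff₀ hgx]
    nlinarith [sq_nonneg (f x - g x)]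
  rw [lintegral_add_left hf.ennreal_ofReal, lintegral_add_right _ hg.ennreal_ofReal,
    lintegral_eq_one hfpos hfone, lintegral_eq_one hgpos hgone] at hle
  exact (ENNReal.add_le_add_iff_right ENNReal.one_ne_top).1 hle

/-- If `m` and `m₁` are the same proportion `p` of `m + h` and `m₁ + h₁` respectively, then
`(m₁ + h₁)² / (m + h)` dominates `h₁² / h`. -/
lemma sq_div_le_sq_add_div_add {m h m₁ h₁ p : ℝ} (hh : 0 < h) (hm : 0 < m)
    (hp : p ∈ Set.Ioo (0 : ℝ) 1) (hc : m * (1 - p) = h * p) (hc₁ : m₁ * (1 - p) = h₁ * p) :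
    h₁ ^ 2 / h ≤ (m₁ + h₁) ^ 2 / (m + h) := by
  have hp1 : 0 < 1 - p := sub_pos.2 hp.2
  have e : h = (m + h) * (1 - p) := by linarith
  have e₁ : h₁ = (m₁ + h₁) * (1 - p) := by linarith
  rw [div_le_div_iff₀ hh (by positivity)]
  calc h₁ ^ 2 * (m + h) = ((m₁ + h₁) * (1 - p)) ^ 2 * (m + h) := by rw [← e₁]
    _ = (m₁ + h₁) ^ 2 * ((m + h) * (1 - p)) * (1 - p) := by ring
    _ = (m₁ + h₁) ^ 2 * h * (1 - p) := by rw [← e]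
    _ ≤ (m₁ + h₁) ^ 2 * h := mul_le_of_le_one_right (by positivity) (by linarith [hp.1])

/-- for two data distributions with the same class weights, both consistent
with the same ground-truth function `phat`,
`∫ P_D̂(x)²/P_D(x) dμ ≥ qH · (D_χ²(P̂H ‖ PH) + 1)`, where the (possibly infinite)
integrals are taken in `ℝ≥0∞` and `D_χ²(P₁‖P₂) = ∫ P₁²/P₂ dμ − 1`. -/
theorem chiSq_lower_bound_joint
    {X : Type*} [MeasurableSpace X] (μ : Measure X) [SigmaFinite μ]
    (qM qH : ℝ) (PM PH PMh PHh phat : X → ℝ)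
    (hqM : qM ∈ Set.Ioo (0 : ℝ) 1) (hqH : qH ∈ Set.Ioo (0 : ℝ) 1) (hq : qM + qH = 1)
    (hPMmeas : Measurable PM) (hPHmeas : Measurable PH)
    (hPMpos : ∀ x, 0 < PM x) (hPHpos : ∀ x, 0 < PH x)
    (hPMone : ∫ x, PM x ∂μ = 1) (hPHone : ∫ x, PH x ∂μ = 1)
    (hPMhmeas : Measurable PMh) (hPHhmeas : Measurable PHh)
    (hPMhpos : ∀ x, 0 < PMh x) (hPHhpos : ∀ x, 0 < PHh x)
    (hPMhone : ∫ x, PMh x ∂μ = 1) (hPHhone : ∫ x, PHh x ∂μ = 1)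
    (hphatmeas : Measurable phat) (hphat : ∀ x, phat x ∈ Set.Ioo (0 : ℝ) 1)
    (hcons : ∀ x, qM * PM x * (1 - phat x) = qH * PH x * phat x)
    (hconsh : ∀ x, qM * PMh x * (1 - phat x) = qH * PHh x * phat x) :
    ENNReal.ofReal qH * ((∫⁻ x, ENNReal.ofReal (PHh x ^ 2 / PH x) ∂μ) - 1 + 1)
      ≤ ∫⁻ x, ENNReal.ofReal
          ((qM * PMh x + qH * PHh x) ^ 2 / (qM * PM x + qH * PH x)) ∂μ := by
  rw [tsub_add_cancel_of_le
      (one_le_lintegral_sq_div hPHhmeas hPHmeas hPHhpos hPHpos hPHhone hPHone),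
    ← lintegral_const_mul' _ _ ENNReal.ofReal_ne_top]
  refine lintegral_mono fun x => ?_
  rw [← ENNReal.ofReal_mul hqH.1.le]
  refine ENNReal.ofReal_le_ofReal ?_
  have hqH0 := hqH.1.ne'
  have hPH0 := (hPHpos x).ne'
  calc qH * (PHh x ^ 2 / PH x) = (qH * PHh x) ^ 2 / (qH * PH x) := by field_simp
    _ ≤ _ := sq_div_le_sq_add_div_add (mul_pos hqH.1 (hPHpos x)) (mul_pos hqM.1 (hPMpos x))
      (hphat x) (hcons x) (hconsh x)
end

section
/- Let D = (q_M, q_H, P_M, P_H) and D̂ = (q_M, q_H, P̂_M, P̂_H) be two data distributions with the same class weights, both consistent with the same ground-truth function p̂, with ∫ H(p̂(x))·P_D̂(x) dμ(x) finite. Let Δ₀ > 0 and let f : X → (0,1) be a classifier with d(p̂(x)‖f(x)) = Δ₀·P_D̂(x)/P_D(x) for all x ∈ X, where P_D and P_D̂ are the joint text densities of D and D̂. Then L(f|D̂) − ∫ H(p̂(x))·P_D̂(x) dμ(x) = Δ₀·∫ P_D̂(x)²/P_D(x) dμ(x) ≥ q_H·Δ₀·(D_χ²(P̂_H‖P_H)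 + 1). -/
open MeasureTheory Real

/-- Binary entropy `H(p) = −p·log p − (1−p)·log(1−p)`. -/
noncomputable def binH (p : ℝ) : ℝ := -(p * Real.log p) - (1 - p) * Real.log (1 - p)

/-- Binary KL divergence `d(p‖q) = p·log(p/q) + (1−p)·log((1−p)/(1−q))`. -/
noncomputable def binKL (p q : ℝ) : ℝ :=
  p * Real.log (p / q) + (1 - p) * Real.log ((1 - p) / (1 - q))

theorem lintegral_ofReal_eq_one {X : Type*} [MeasurableSpace X] {μ : Measure X} {P : X → ℝ}
    (hP : ∀ x, 0 < P x) (hone : ∫ x, P x ∂μ = 1) : ∫⁻ x, ENNReal.ofReal (P x) ∂μ = 1 := by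
  have hint : Integrable P μ := .of_integral_ne_zero (by simp [hone])
  rw [← ofReal_integral_eq_lintegral_ofReal hint (.of_forall fun x => (hP x).le), hone,
    ENNReal.ofReal_one]

/-- Nonnegativity of the Pearson `χ²` divergence. -/
theorem one_le_lintegral_sq_div_s7 {X : Type*} [MeasurableSpace X] {μ : Measure X} {P Q : X → ℝ}
    (hQmeas : Measurable Q) (hP : ∀ x, 0 < P x) (hQ : ∀ x, 0 < Q x)
    (hPone : ∫ x, P x ∂μ = 1) (hQone : ∫ x, Q x ∂μ = 1) :
    1 ≤ ∫⁻ x, ENNReal.ofReal (P x ^ 2 / Q x) ∂μ := by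
  have key : ∫⁻ x, ENNReal.ofReal 2 * ENNReal.ofReal (P x) ∂μ
      ≤ ∫⁻ x, (ENNReal.ofReal (P x ^ 2 / Q x) + ENNReal.ofReal (Q x)) ∂μ := by
    refine lintegral_mono fun x => ?_
    have hx := hQ x
    rw [← ENNReal.ofReal_mul zero_le_two, ← ENNReal.ofReal_add (by positivity) hx.le]
    refine ENNReal.ofReal_le_ofReal ?_
    have h : P x ^ 2 / Q x + Q x - 2 * P x = (P x - Q x) ^ 2 / Q x := by
      field_simp
      ring
    have : 0 ≤ (P x - Q x) ^ 2 / Q x := by positivity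
    linarith
  rw [lintegral_const_mul' _ _ ENNReal.ofReal_ne_top,
    lintegral_add_right _ hQmeas.ennreal_ofReal, lintegral_ofReal_eq_one hP hPone,
    lintegral_ofReal_eq_one hQ hQone, mul_one, ENNReal.ofReal_ofNat,
    ← one_add_one_eq_two] at key
  exact (ENNReal.add_le_add_iff_right ENNReal.one_ne_top).1 key

theorem binH_nonneg {p : ℝ} (hp : p ∈ Set.Ioo (0 : ℝ) 1) : 0 ≤ binH p := by
  have h1 := mul_nonpos_of_nonneg_of_nonpos hp.1.le (Real.log_nonpos hp.1.le hp.2.le)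
  have h2 := mul_nonpos_of_nonneg_of_nonpos (sub_nonneg.2 hp.2.le)
    (Real.log_nonpos (sub_nonneg.2 hp.2.le) (sub_le_self 1 hp.1.le))
  unfold binH
  linarith

theorem binH_add_binKL {p q : ℝ} (hp : p ∈ Set.Ioo (0 : ℝ) 1) (hq : q ∈ Set.Ioo (0 : ℝ) 1) :
    binH p + binKL p q = -(p * Real.log q + (1 - p) * Real.log (1 - q)) := by
  unfold binH binKL
  rw [Real.log_div hp.1.ne' hq.1.ne',
    Real.log_div (sub_pos.2 hp.2).ne' (sub_pos.2 hq.2).ne']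
  ring

/-- for two data distributions `D, D̂` with the same class weights, both
consistent with `phat`, with `∫ H(phat x)·P_D̂ x dμ` finite, `Δ₀ > 0`, and a classifier
`f` with `d(phat x ‖ f x) = Δ₀·P_D̂ x / P_D x` for all `x`, the loss of `f` on `D̂`
satisfies `L(f|D̂) − ∫ H(phat)·P_D̂ dμ = Δ₀·∫ P_D̂²/P_D dμ ≥ qH·Δ₀·(D_χ²(P̂H‖PH)+1)`.
Losses and the possibly-infinite integrals are taken in `ℝ≥0∞`. -/
theorem generalization_loss_identity_and_bound
    {X : Type*} [MeasurableSpace X] (μ : Measure X) [SigmaFinite μ]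
    (qM qH : ℝ) (PM PH PMh PHh phat f : X → ℝ) (Δ₀ : ℝ)
    (hqM : qM ∈ Set.Ioo (0 : ℝ) 1) (hqH : qH ∈ Set.Ioo (0 : ℝ) 1) (hq : qM + qH = 1)
    (hPMmeas : Measurable PM) (hPHmeas : Measurable PH)
    (hPMpos : ∀ x, 0 < PM x) (hPHpos : ∀ x, 0 < PH x)
    (hPMone : ∫ x, PM x ∂μ = 1) (hPHone : ∫ x, PH x ∂μ = 1)
    (hPMhmeas : Measurable PMh) (hPHhmeas : Measurable PHh)
    (hPMhpos : ∀ x, 0 < PMh x) (hPHhpos : ∀ x, 0 < PHh x)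
    (hPMhone : ∫ x, PMh x ∂μ = 1) (hPHhone : ∫ x, PHh x ∂μ = 1)
    (hphatmeas : Measurable phat) (hphat : ∀ x, phat x ∈ Set.Ioo (0 : ℝ) 1)
    (hcons : ∀ x, qM * PM x * (1 - phat x) = qH * PH x * phat x)
    (hconsh : ∀ x, qM * PMh x * (1 - phat x) = qH * PHh x * phat x)
    (hHfin : Integrable (fun x => binH (phat x) * (qM * PMh x + qH * PHh x)) μ)
    (hΔ₀ : 0 < Δ₀)
    (hfmeas : Measurable f) (hf : ∀ x, f x ∈ Set.Ioo (0 : ℝ) 1)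
    (hsub : ∀ x, binKL (phat x) (f x)
      = Δ₀ * (qM * PMh x + qH * PHh x) / (qM * PM x + qH * PH x)) :
    (∫⁻ x, ENNReal.ofReal
          (-(qM * PMh x * Real.log (f x) + qH * PHh x * Real.log (1 - f x))) ∂μ)
        - ENNReal.ofReal (∫ x, binH (phat x) * (qM * PMh x + qH * PHh x) ∂μ)
      = ENNReal.ofReal Δ₀
          * ∫⁻ x, ENNReal.ofReal
              ((qM * PMh x + qH * PHh x) ^ 2 / (qM * PM x + qH * PH x)) ∂μ
    ∧ ENNReal.ofReal (qH * Δ₀)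
          * ((∫⁻ x, ENNReal.ofReal (PHh x ^ 2 / PH x) ∂μ) - 1 + 1)
        ≤ ENNReal.ofReal Δ₀
          * ∫⁻ x, ENNReal.ofReal
              ((qM * PMh x + qH * PHh x) ^ 2 / (qM * PM x + qH * PH x)) ∂μ := by
  have hS : ∀ x, 0 < qM * PM x + qH * PH x := fun x =>
    add_pos (mul_pos hqM.1 (hPMpos x)) (mul_pos hqH.1 (hPHpos x))
  have hSh : ∀ x, 0 < qM * PMh x + qH * PHh x := fun x =>
    add_pos (mul_pos hqM.1 (hPMhpos x)) (mul_pos hqH.1 (hPHhpos x))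
  constructor
  · have hpt : ∀ x, ENNReal.ofReal
          (-(qM * PMh x * Real.log (f x) + qH * PHh x * Real.log (1 - f x)))
        = ENNReal.ofReal (binH (phat x) * (qM * PMh x + qH * PHh x))
          + ENNReal.ofReal Δ₀ * ENNReal.ofReal
              ((qM * PMh x + qH * PHh x) ^ 2 / (qM * PM x + qH * PH x)) := by
      intro x
      have h := hSh x
      have h' := hS x
      rw [← ENNReal.ofReal_mul hΔ₀.le,
        ← ENNReal.ofReal_add (mul_nonneg (binH_nonneg (hphat x)) h.le) (by positivity)]
      congr 1
      have hKL : Δ₀ * ((qM * PMh x + qH * PHh x) ^ 2 / (qM * PM x + qH * PH x))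
          = binKL (phat x) (f x) * (qM * PMh x + qH * PHh x) := by
        rw [hsub x]
        ring
      rw [hKL, ← add_mul, binH_add_binKL (hphat x) (hf x)]
      linear_combination (Real.log (1 - f x) - Real.log (f x)) * hconsh x
    simp_rw [hpt]
    rw [lintegral_add_left' hHfin.aemeasurable.ennreal_ofReal,
      lintegral_const_mul' _ _ ENNReal.ofReal_ne_top,
      ofReal_integral_eq_lintegral_ofReal hHfin
        (.of_forall fun x => mul_nonneg (binH_nonneg (hphat x)) (hSh x).le)]
    refine ENNReal.add_sub_cancel_left ?_
    rw [← ofReal_integral_eq_lintegral_ofReal hHfin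
        (.of_forall fun x => mul_nonneg (binH_nonneg (hphat x)) (hSh x).le)]
    exact ENNReal.ofReal_ne_top
  · rw [tsub_add_cancel_of_le
        (one_le_lintegral_sq_div_s7 hPHmeas hPHhpos hPHpos hPHhone hPHone),
      mul_comm qH, ENNReal.ofReal_mul hΔ₀.le, mul_assoc,
      ← lintegral_const_mul' _ _ ENNReal.ofReal_ne_top]
    gcongr with x
    rw [← ENNReal.ofReal_mul hqH.1.le]
    refine ENNReal.ofReal_le_ofReal ?_
    have h := hSh x
    have h' := hS x
    have hp : 0 < 1 - phat x := sub_pos.2 (hphat x).2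
    have e : qH * PH x = (qM * PM x + qH * PH x) * (1 - phat x) := by
      linear_combination -hcons x
    have eh : qH * PHh x = (qM * PMh x + qH * PHh x) * (1 - phat x) := by
      linear_combination -hconsh x
    calc qH * (PHh x ^ 2 / PH x) = (qH * PHh x) ^ 2 / (qH * PH x) := by
          have := hqH.1
          have := hPHpos x
          field_simp
      _ = (qM * PMh x + qH * PHh x) ^ 2 / (qM * PM x + qH * PH x) * (1 - phat x) := by
          have aux : ∀ a b c : ℝ, 0 < b → 0 < c → (a * c) ^ 2 / (b * c) = a ^ 2 / b * c := by
            intro a b c hb hc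
            field_simp
          exact (congrArg₂ (fun u v => u ^ 2 / v) eh e).trans (aux _ _ _ h' hp)
      _ ≤ _ := mul_le_of_le_one_right (by positivity) (sub_le_self 1 (hphat x).1.le)
end

section
/- (Theorem 1: good data, bad classifier.) Let D = (q_M, q_H, P_M, P_H) and D̂ = (q_M, q_H, P̂_M, P̂_H) be two data distributions with the same class weights, both consistent with the same ground-truth function p̂, with ∫ H(p̂(x))·P_D(x) dμ(x) and ∫ H(p̂(x))·P_D̂(x) dμ(x) finite and with D* := D_χ²(P̂_H‖P_H) finite. Then for every Δ > 0 there exists a classifier f : X → (0,1) such that: (i) L(f|D) < ∫ H(p̂(x))·P_D(x) dμ(x) + Δ, and (ii) L(f|D̂) > ∫ H(p̂(x))·P_D̂(x) dμ(x) + 0.9·q_H·(D* + 1)·Δ. -/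
open MeasureTheory Real

/-- The Kullback–Leibler divergence between Bernoulli laws with parameters `p` and `a`. -/
noncomputable def bernoulliKL (p a : ℝ) : ℝ :=
  p * (log p - log a) + (1 - p) * (log (1 - p) - log (1 - a))

theorem hasDerivAt_bernoulliKL {p a : ℝ} (ha : 0 < a) (ha' : a < 1) :
    HasDerivAt (bernoulliKL p) ((a - p) / (a * (1 - a))) a := by
  have h1 : 1 - a ≠ 0 := by linarith
  have hlog := ((Real.hasDerivAt_log ha.ne').const_sub (log p)).const_mul p
  have hlog' := ((((hasDerivAt_id a).const_sub 1).log h1).const_sub (log (1 - p))).const_mul (1 - p)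
  refine (hlog.add hlog').congr_deriv ?_
  simp only [id]
  field_simp
  ring

theorem strictMonoOn_bernoulliKL {p : ℝ} (hp : 0 < p) :
    StrictMonoOn (bernoulliKL p) (Set.Ico p 1) := by
  refine strictMonoOn_of_deriv_pos (convex_Ico p 1) (fun a ha ↦ ?_) (fun a ha ↦ ?_)
  · exact (hasDerivAt_bernoulliKL (hp.trans_le ha.1) ha.2).continuousAt.continuousWithinAt
  · rw [interior_Ico] at ha
    have h0 : 0 < a := hp.trans ha.1
    rw [(hasDerivAt_bernoulliKL h0 ha.2).deriv]
    exact div_pos (sub_pos.2 ha.1) (mul_pos h0 (sub_pos.2 ha.2))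

theorem exists_bernoulliKL_eq {p g : ℝ} (hp : p ∈ Set.Ioo (0 : ℝ) 1) (hg : 0 ≤ g) :
    ∃ a ∈ Set.Ico p 1, bernoulliKL p a = g := by
  obtain ⟨hp0, hp1⟩ := hp
  have hq : 0 < 1 - p := sub_pos.2 hp1
  have hlogp : p * log p ≤ 0 := mul_nonpos_of_nonneg_of_nonpos hp0.le (log_nonpos hp0.le hp1.le)
  set t := (g - p * log p) / (1 - p) with ht
  have ht0 : 0 ≤ t := div_nonneg (by linarith) hq.le
  set b := 1 - (1 - p) * exp (-t) with hb
  have hb1 : b < 1 := by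
    have := mul_pos hq (exp_pos (-t))
    linarith
  have hpb : p ≤ b := by
    have := mul_le_of_le_one_right hq.le (exp_le_one_iff.2 (neg_nonpos.2 ht0))
    linarith
  have hlogb : log (1 - b) = log (1 - p) - t := by
    rw [hb, sub_sub_cancel, log_mul hq.ne' (exp_pos _).ne', log_exp, ← sub_eq_add_neg]
  have hgb : g ≤ bernoulliKL p b := by
    have h1 : p * log b ≤ 0 :=
      mul_nonpos_of_nonneg_of_nonpos hp0.le (log_nonpos (hp0.le.trans hpb) hb1.le)
    have h2 : (1 - p) * t = g - p * log p := mul_div_cancel₀ _ hq.ne'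
    rw [bernoulliKL, hlogb]
    linarith
  have hcont : ContinuousOn (bernoulliKL p) (Set.Icc p b) := fun a ha ↦
    (hasDerivAt_bernoulliKL (hp0.trans_le ha.1)
      (ha.2.trans_lt hb1)).continuousAt.continuousWithinAt
  obtain ⟨a, ha, hag⟩ := intermediate_value_Icc hpb hcont
    (show g ∈ Set.Icc _ _ from ⟨by simpa [bernoulliKL] using hg, hgb⟩)
  exact ⟨a, ⟨ha.1, ha.2.trans_lt hb1⟩, hag⟩

theorem exists_measurable_bernoulliKL_eq {X : Type*} [MeasurableSpace X] {p g : X → ℝ}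
    (hp : Measurable p) (hp01 : ∀ x, p x ∈ Set.Ioo (0 : ℝ) 1)
    (hg : Measurable g) (hg0 : ∀ x, 0 ≤ g x) :
    ∃ f : X → ℝ, Measurable f ∧ (∀ x, f x ∈ Set.Ioo (0 : ℝ) 1) ∧
      ∀ x, bernoulliKL (p x) (f x) = g x := by
  choose f hf hfg using fun x ↦ exists_bernoulliKL_eq (hp01 x) (hg0 x)
  refine ⟨f, measurable_of_Iic fun a ↦ ?_, fun x ↦ ⟨(hp01 x).1.trans_le (hf x).1, (hf x).2⟩, hfg⟩
  rcases le_or_gt 1 a with ha | ha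
  · convert MeasurableSet.univ
    exact Set.eq_univ_of_forall fun x ↦ (hf x).2.le.trans ha
  · have hset : f ⁻¹' Set.Iic a = {x | p x ≤ a} ∩ {x | g x ≤ bernoulliKL (p x) a} := by
      ext x
      simp only [Set.mem_preimage, Set.mem_Iic, Set.mem_inter_iff, Set.mem_ofPred_eq]
      constructor
      · intro h
        have hpa := (hf x).1.trans h
        refine ⟨hpa, ?_⟩
        rw [← hfg x]
        exact (strictMonoOn_bernoulliKL (hp01 x).1).monotoneOn (hf x) ⟨hpa, ha⟩ h
      · rintro ⟨hpa, h⟩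
        rw [← hfg x] at h
        exact ((strictMonoOn_bernoulliKL (hp01 x).1).le_iff_le (hf x) ⟨hpa, ha⟩).1 h
    rw [hset]
    refine (measurableSet_le hp measurable_const).inter (measurableSet_le hg ?_)
    unfold bernoulliKL
    fun_prop

theorem cross_entropy_eq_binH_add_bernoulliKL {m h p : ℝ} (hc : m * (1 - p) = h * p) (a : ℝ) :
    m * log a + h * log (1 - a) = -(binH p * (m + h) + (m + h) * bernoulliKL p a) := by
  have h1 : (m + h) * p = m := by linarith
  have h2 : (m + h) * (1 - p) = h := by linarith
  unfold binH bernoulliKL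
  linear_combination -(log a) * h1 - log (1 - a) * h2

/-- Theorem 1: good data, bad classifier: for two data distributions
`D, D̂` with the same class weights, both consistent with `phat`, with
`∫ H(phat)·P_D dμ`, `∫ H(phat)·P_D̂ dμ` finite and `D* := D_χ²(P̂H‖PH)` finite, for
every `Δ > 0` there is a classifier `f` with
`L(f|D) < ∫ H(phat)·P_D dμ + Δ` and
`L(f|D̂) > ∫ H(phat)·P_D̂ dμ + 0.9·qH·(D* + 1)·Δ`. -/
theorem good_data_bad_classifier
    {X : Type*} [MeasurableSpace X] (μ : Measure X) [SigmaFinite μ]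
    (qM qH : ℝ) (PM PH PMh PHh phat : X → ℝ)
    (hqM : qM ∈ Set.Ioo (0 : ℝ) 1) (hqH : qH ∈ Set.Ioo (0 : ℝ) 1) (hq : qM + qH = 1)
    (hPMmeas : Measurable PM) (hPHmeas : Measurable PH)
    (hPMpos : ∀ x, 0 < PM x) (hPHpos : ∀ x, 0 < PH x)
    (hPMone : ∫ x, PM x ∂μ = 1) (hPHone : ∫ x, PH x ∂μ = 1)
    (hPMhmeas : Measurable PMh) (hPHhmeas : Measurable PHh)
    (hPMhpos : ∀ x, 0 < PMh x) (hPHhpos : ∀ x, 0 < PHh x)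
    (hPMhone : ∫ x, PMh x ∂μ = 1) (hPHhone : ∫ x, PHh x ∂μ = 1)
    (hphatmeas : Measurable phat) (hphat : ∀ x, phat x ∈ Set.Ioo (0 : ℝ) 1)
    (hcons : ∀ x, qM * PM x * (1 - phat x) = qH * PH x * phat x)
    (hconsh : ∀ x, qM * PMh x * (1 - phat x) = qH * PHh x * phat x)
    (hHfin : Integrable (fun x => binH (phat x) * (qM * PM x + qH * PH x)) μ)
    (hHhfin : Integrable (fun x => binH (phat x) * (qM * PMh x + qH * PHh x)) μ)
    (hDfin : Integrable (fun x => PHh x ^ 2 / PH x) μ) :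
    ∀ Δ : ℝ, 0 < Δ →
      ∃ f : X → ℝ, Measurable f ∧ (∀ x, f x ∈ Set.Ioo (0 : ℝ) 1) ∧
        (-∫ x, (qM * PM x * Real.log (f x) + qH * PH x * Real.log (1 - f x)) ∂μ
            < ∫ x, binH (phat x) * (qM * PM x + qH * PH x) ∂μ + Δ)
        ∧ (-∫ x, (qM * PMh x * Real.log (f x) + qH * PHh x * Real.log (1 - f x)) ∂μ
            > ∫ x, binH (phat x) * (qM * PMh x + qH * PHh x) ∂μ
              + 0.9 * qH * (((∫ x, PHh x ^ 2 / PH x ∂μ) - 1) + 1) * Δ) := by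
  intro Δ hΔ
  have hqH0 := hqH.1
  set c : ℝ := 0.95 * Δ with hc
  have hc0 : 0 < c := by positivity
  have hq1 : ∀ x, 0 < 1 - phat x := fun x ↦ sub_pos.2 (hphat x).2
  obtain ⟨f, hf, hf01, hfK⟩ := exists_measurable_bernoulliKL_eq
    (g := fun x ↦ c * PHh x * (1 - phat x) / (qH * PH x)) hphatmeas hphat (by fun_prop)
    (fun x ↦ div_nonneg (mul_nonneg (mul_nonneg hc0.le (hPHhpos x).le) (hq1 x).le)
      (mul_pos hqH0 (hPHpos x)).le)
  have hPHint : Integrable PH μ := .of_integral_ne_zero (by simp [hPHone])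
  have hPHhint : Integrable PHh μ := .of_integral_ne_zero (by simp [hPHhone])
  have hI : 1 ≤ ∫ x, PHh x ^ 2 / PH x ∂μ := by
    have hmono := integral_mono ((hPHhint.const_mul 2).sub hPHint) hDfin fun x ↦ by
      simp only [Pi.sub_apply]
      rw [le_div_iff₀ (hPHpos x)]
      nlinarith [sq_nonneg (PHh x - PH x)]
    simp only [Pi.sub_apply] at hmono
    rw [integral_sub (hPHhint.const_mul 2) hPHint, integral_const_mul, hPHone, hPHhone] at hmono
    linarith
  have hD : -∫ x, (qM * PM x * log (f x) + qH * PH x * log (1 - f x)) ∂μ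
      = ∫ x, binH (phat x) * (qM * PM x + qH * PH x) ∂μ + c := by
    have hpt : ∀ x, qM * PM x * log (f x) + qH * PH x * log (1 - f x)
        = -(binH (phat x) * (qM * PM x + qH * PH x) + c * PHh x) := fun x ↦ by
      have h0 := (hPHpos x).ne'
      have h2 : (qM * PM x + qH * PH x) * (1 - phat x) = qH * PH x := by linarith [hcons x]
      rw [cross_entropy_eq_binH_add_bernoulliKL (hcons x), hfK x]
      congr 2
      field_simp
      linear_combination PHh x * h2
    simp_rw [hpt]
    rw [integral_neg, neg_neg, integral_add hHfin (hPHhint.const_mul c), integral_const_mul,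
      hPHhone, mul_one]
  have hDh : -∫ x, (qM * PMh x * log (f x) + qH * PHh x * log (1 - f x)) ∂μ
      = ∫ x, binH (phat x) * (qM * PMh x + qH * PHh x) ∂μ
        + c * ∫ x, PHh x ^ 2 / PH x ∂μ := by
    have hpt : ∀ x, qM * PMh x * log (f x) + qH * PHh x * log (1 - f x)
        = -(binH (phat x) * (qM * PMh x + qH * PHh x) + c * (PHh x ^ 2 / PH x)) := fun x ↦ by
      have h0 := (hPHpos x).ne'
      have h2 : (qM * PMh x + qH * PHh x) * (1 - phat x) = qH * PHh x := by linarith [hconsh x]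
      rw [cross_entropy_eq_binH_add_bernoulliKL (hconsh x), hfK x]
      congr 2
      field_simp
      linear_combination PHh x * h2
    simp_rw [hpt]
    rw [integral_neg, neg_neg, integral_add hHhfin (hDfin.const_mul c), integral_const_mul]
  refine ⟨f, hf, hf01, ?_, ?_⟩
  · rw [hD]
    linarith
  · rw [hDh, sub_add_cancel, gt_iff_lt, add_lt_add_iff_left, mul_right_comm]
    refine mul_lt_mul_of_pos_right ?_ (by linarith)
    nlinarith [mul_lt_mul_of_pos_right hqH.2 hΔ]
end
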